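/- Assume char k ≠ 2. There does not exist a Hecke symmetry R as in the standing setup (i.e., with Im(q·Id − R) = Υ² for some invertible ζ) for which dim U > 1, where U := span{ℓ_{xx} : x ∈ V} ⊆ V*. Equivalently: for every invertible linear operator ζ on V and every Hecke symmetry R on V with parameter q such that Im(q·Id_{V⊗V} − R) = Υ², the subspace span{ℓ_{xx} : x ∈ V} of V* has dimension at most 1. -/

import Mathlib

open TensorProduct LinearMap

noncomputable section

variable (k V : Type) [Field k] [AddCommGroup V] [Module k V]

/-- `R ⊗ Id` acting on `V ⊗ (V ⊗ V)`. -/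
def op12 (R : V ⊗[k] V →ₗ[k] V ⊗[k] V) :
    V ⊗[k] (V ⊗[k] V) →ₗ[k] V ⊗[k] (V ⊗[k] V) :=
  (TensorProduct.assoc k V V V).toLinearMap ∘ₗ LinearMap.rTensor V R ∘ₗ
    (TensorProduct.assoc k V V V).symm.toLinearMap

/-- `Id ⊗ R` acting on `V ⊗ (V ⊗ V)`. -/
def op23 (R : V ⊗[k] V →ₗ[k] V ⊗[k] V) :
    V ⊗[k] (V ⊗[k] V) →ₗ[k] V ⊗[k] (V ⊗[k] V) :=
  LinearMap.lTensor V R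

/-- A Hecke symmetry with parameter `q`: an operator on `V ⊗ V` satisfying the braid
equation and the Hecke relation `(R - q·Id)(R + Id) = 0`, with `q ≠ 0`. -/
def IsHeckeSymmetry (q : k) (R : V ⊗[k] V →ₗ[k] V ⊗[k] V) : Prop :=
  q ≠ 0 ∧
    op12 k V R ∘ₗ op23 k V R ∘ₗ op12 k V R = op23 k V R ∘ₗ op12 k V R ∘ₗ op23 k V R ∧
    (R - q • LinearMap.id) ∘ₗ (R + LinearMap.id) = 0

/-- `x ⋏ y = ζ(x) ⊗ y - ζ(y) ⊗ x`. -/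
def wedge2 (ζ : V ≃ₗ[k] V) (x y : V) : V ⊗[k] V := ζ x ⊗ₜ[k] y - ζ y ⊗ₜ[k] x

/-- `Υ²`, the span of the tensors `x ⋏ y`. -/
def Ups2 (ζ : V ≃ₗ[k] V) : Submodule k (V ⊗[k] V) :=
  Submodule.span k {w : V ⊗[k] V | ∃ x y : V, w = wedge2 k V ζ x y}

/-- `x ⋏ y ⋏ z`. -/
def wedge3 (ζ : V ≃ₗ[k] V) (x y z : V) : V ⊗[k] (V ⊗[k] V) :=
  ζ (ζ x) ⊗ₜ[k] (ζ y ⊗ₜ[k] z) + ζ (ζ y) ⊗ₜ[k] (ζ z ⊗ₜ[k] x) + ζ (ζ z) ⊗ₜ[k] (ζ x ⊗ₜ[k] y)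
    - ζ (ζ x) ⊗ₜ[k] (ζ z ⊗ₜ[k] y) - ζ (ζ y) ⊗ₜ[k] (ζ x ⊗ₜ[k] z) - ζ (ζ z) ⊗ₜ[k] (ζ y ⊗ₜ[k] x)

/-- `Υ³`, the span of the tensors `x ⋏ y ⋏ z` (which coincides with
`(V ⊗ Υ²) ∩ (Υ² ⊗ V)`). -/
def Ups3 (ζ : V ≃ₗ[k] V) : Submodule k (V ⊗[k] (V ⊗[k] V)) :=
  Submodule.span k {t : V ⊗[k] (V ⊗[k] V) | ∃ x y z : V, t = wedge3 k V ζ x y z}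

/-- The bilinear extension `w ↦ x ⋏ w` of the wedge multiplication `V × Υ² → Υ³`:
on elements of `Υ²` it satisfies `x ⋏ (y ⋏ z) = x ⋏ y ⋏ z`. -/
def wedge31 (ζ : V ≃ₗ[k] V) (x : V) : V ⊗[k] V →ₗ[k] V ⊗[k] (V ⊗[k] V) :=
  TensorProduct.mk k V (V ⊗[k] V) (ζ (ζ x)) +
    (TensorProduct.assoc k V V V).toLinearMap ∘ₗ
      ((TensorProduct.mk k (V ⊗[k] V) V).flip x ∘ₗ
        TensorProduct.map ζ.toLinearMap ζ.toLinearMap) -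
    TensorProduct.map ζ.toLinearMap (TensorProduct.mk k V V (ζ x))

/-- The skewsymmetrizer `Y = q·Id - R`. -/
def skewY (q : k) (R : V ⊗[k] V →ₗ[k] V ⊗[k] V) : V ⊗[k] V →ₗ[k] V ⊗[k] V :=
  q • LinearMap.id - R

/-- `R' = (ζ⁻¹ ⊗ ζ⁻¹) ∘ R ∘ (ζ ⊗ ζ)`. -/
def Rprime (ζ : V ≃ₗ[k] V) (R : V ⊗[k] V →ₗ[k] V ⊗[k] V) :
    V ⊗[k] V →ₗ[k] V ⊗[k] V :=
  TensorProduct.map ζ.symm.toLinearMap ζ.symm.toLinearMap ∘ₗ R ∘ₗ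
    TensorProduct.map ζ.toLinearMap ζ.toLinearMap

/-- `ℓ_{xy}(z) = ω̃(x ⋏ Y(ζ(y) ⊗ z))`, where `Ω` is a linear extension of `ω̃` to
`V ⊗ V ⊗ V`. -/
def ell (ζ : V ≃ₗ[k] V) (Y : V ⊗[k] V →ₗ[k] V ⊗[k] V)
    (Ω : V ⊗[k] (V ⊗[k] V) →ₗ[k] k) (x y : V) : Module.Dual k V :=
  Ω ∘ₗ wedge31 k V ζ x ∘ₗ Y ∘ₗ TensorProduct.mk k V V (ζ y)

/-- The linear forms `ℓ_{xy}` associated with the Hecke symmetry `R`. -/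
def ellF (ζ : V ≃ₗ[k] V) (q : k) (R : V ⊗[k] V →ₗ[k] V ⊗[k] V)
    (Ω : V ⊗[k] (V ⊗[k] V) →ₗ[k] k) (x y : V) : Module.Dual k V :=
  ell k V ζ (skewY k V q R) Ω x y

/-- The linear forms `ℓ'_{xy}` associated with the twisted Hecke symmetry `R'`. -/
def ellF' (ζ : V ≃ₗ[k] V) (q : k) (R : V ⊗[k] V →ₗ[k] V ⊗[k] V)
    (Ω : V ⊗[k] (V ⊗[k] V) →ₗ[k] k) (x y : V) : Module.Dual k V :=
  ell k V ζ (skewY k V q (Rprime k V ζ R)) Ω x y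

section Core

/-- The polarization of the adjugate of `3 × 3` matrices. -/
def mixAdj {K : Type} [Field K] (M N : Matrix (Fin 3) (Fin 3) K) : Matrix (Fin 3) (Fin 3) K :=
  Matrix.of fun c k =>
    M (k + 1) (c + 1) * N (k + 2) (c + 2) + N (k + 1) (c + 1) * M (k + 2) (c + 2)
      - M (k + 1) (c + 2) * N (k + 2) (c + 1) - N (k + 1) (c + 2) * M (k + 2) (c + 1)

/-- The trilinear form on `K³` with coefficients `τ`. -/
def tri {K : Type} [Field K] (τ : Fin 3 → Fin 3 → Fin 3 → K) (x y z : Fin 3 → K) : K :=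
  ∑ i, ∑ j, ∑ l, τ i j l * x i * y j * z l

/-- The property of being a polynomial function on `K³`. -/
def IsPolyFun {K : Type} [Field K] (f : (Fin 3 → K) → K) : Prop :=
  ∃ p : MvPolynomial (Fin 3) K, ∀ x, f x = MvPolynomial.eval x p

variable {K : Type} [Field K]

lemma IsPolyFun.const (a : K) : IsPolyFun (fun _ : Fin 3 → K => a) :=
  ⟨MvPolynomial.C a, by simp⟩

lemma IsPolyFun.coord (i : Fin 3) : IsPolyFun (fun x : Fin 3 → K => x i) :=
  ⟨MvPolynomial.X i, by simp⟩

lemma IsPolyFun.add {f g : (Fin 3 → K) → K} (hf : IsPolyFun f) (hg : IsPolyFun g) :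
    IsPolyFun (fun x => f x + g x) := by
  obtain ⟨p, hp⟩ := hf
  obtain ⟨r, hr⟩ := hg
  exact ⟨p + r, fun x => by simp [hp, hr]⟩

lemma IsPolyFun.mul {f g : (Fin 3 → K) → K} (hf : IsPolyFun f) (hg : IsPolyFun g) :
    IsPolyFun (fun x => f x * g x) := by
  obtain ⟨p, hp⟩ := hf
  obtain ⟨r, hr⟩ := hg
  exact ⟨p * r, fun x => by simp [hp, hr]⟩

lemma IsPolyFun.sum {ι : Type} (s : Finset ι) {f : ι → (Fin 3 → K) → K}
    (hf : ∀ i, IsPolyFun (f i)) : IsPolyFun (fun x => ∑ i ∈ s, f i x) := by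
  choose p hp using hf
  exact ⟨∑ i ∈ s, p i, fun x => by simp [hp]⟩

lemma IsPolyFun.prod {ι : Type} (s : Finset ι) {f : ι → (Fin 3 → K) → K}
    (hf : ∀ i, IsPolyFun (f i)) : IsPolyFun (fun x => ∏ i ∈ s, f i x) := by
  choose p hp using hf
  exact ⟨∏ i ∈ s, p i, fun x => by simp [hp, map_prod]⟩

lemma IsPolyFun.exists_mul_ne_zero [Infinite K] {f g : (Fin 3 → K) → K} (hf : IsPolyFun f)
    (hg : IsPolyFun g) (hf0 : ∃ x, f x ≠ 0) (hg0 : ∃ x, g x ≠ 0) : ∃ x, f x * g x ≠ 0 := by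
  obtain ⟨p, hp⟩ := hf
  obtain ⟨r, hr⟩ := hg
  by_contra! h
  have hpr : p * r = 0 := MvPolynomial.funext fun x => by
    simpa [hp, hr] using h x
  rcases mul_eq_zero.1 hpr with h0 | h0
  · obtain ⟨x, hx⟩ := hf0
    exact hx (by simp [hp, h0])
  · obtain ⟨x, hx⟩ := hg0
    exact hx (by simp [hr, h0])

lemma IsPolyFun.exists_prod_ne_zero [Infinite K] {ι : Type} (s : Finset ι)
    {f : ι → (Fin 3 → K) → K} (hf : ∀ i, IsPolyFun (f i)) (hf0 : ∀ i ∈ s, ∃ x, f i x ≠ 0) :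
    ∃ x, ∏ i ∈ s, f i x ≠ 0 := by
  classical
  induction s using Finset.induction_on with
  | empty => exact ⟨0, by simp⟩
  | insert a s ha ih =>
    simp only [Finset.prod_insert ha]
    exact (hf a).exists_mul_ne_zero (IsPolyFun.prod s hf) (hf0 a (by simp))
      (ih fun i hi => hf0 i (by simp [hi]))

lemma IsPolyFun.tri (τ : Fin 3 → Fin 3 → Fin 3 → K) {f g h : (Fin 3 → K) → Fin 3 → K}
    (hf : ∀ i, IsPolyFun fun x => f x i) (hg : ∀ i, IsPolyFun fun x => g x i)
    (hh : ∀ i, IsPolyFun fun x => h x i) : IsPolyFun fun x => tri τ (f x) (g x) (h x) :=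
  IsPolyFun.sum _ fun i => IsPolyFun.sum _ fun j => IsPolyFun.sum _ fun l =>
    (((IsPolyFun.const (τ i j l)).mul (hf i)).mul (hg j)).mul (hh l)

lemma isPolyFun_tri_diag (τ : Fin 3 → Fin 3 → Fin 3 → K) (z : Fin 3 → K) :
    IsPolyFun fun x => tri τ x x z :=
  .tri τ IsPolyFun.coord IsPolyFun.coord fun _ => .const _

lemma isPolyFun_tri_right (τ : Fin 3 → Fin 3 → Fin 3 → K) (x y : Fin 3 → K) :
    IsPolyFun fun z => tri τ x y z :=
  .tri τ (fun _ => .const _) (fun _ => .const _) IsPolyFun.coord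

lemma isPolyFun_tri_left (τ : Fin 3 → Fin 3 → Fin 3 → K) (y z : Fin 3 → K) :
    IsPolyFun fun x => tri τ x y z :=
  .tri τ IsPolyFun.coord (fun _ => .const _) (fun _ => .const _)

lemma isPolyFun_tri_cube (τ : Fin 3 → Fin 3 → Fin 3 → K) : IsPolyFun fun x => tri τ x x x :=
  .tri τ IsPolyFun.coord IsPolyFun.coord IsPolyFun.coord

lemma tri_add_mid (τ : Fin 3 → Fin 3 → Fin 3 → K) (x y y' z : Fin 3 → K) :
    tri τ x (y + y') z = tri τ x y z + tri τ x y' z := by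
  simp only [tri, Pi.add_apply, ← Finset.sum_add_distrib]
  refine Finset.sum_congr rfl fun i _ => Finset.sum_congr rfl fun j _ =>
    Finset.sum_congr rfl fun l _ => by ring

lemma tri_add_right (τ : Fin 3 → Fin 3 → Fin 3 → K) (x y z z' : Fin 3 → K) :
    tri τ x y (z + z') = tri τ x y z + tri τ x y z' := by
  simp only [tri, Pi.add_apply, ← Finset.sum_add_distrib]
  refine Finset.sum_congr rfl fun i _ => Finset.sum_congr rfl fun j _ =>
    Finset.sum_congr rfl fun l _ => by ring

lemma tri_smul_right (τ : Fin 3 → Fin 3 → Fin 3 → K) (x y z : Fin 3 → K) (a : K) :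
    tri τ x y (a • z) = a * tri τ x y z := by
  simp only [tri, Pi.smul_apply, smul_eq_mul, Finset.mul_sum]
  refine Finset.sum_congr rfl fun i _ => Finset.sum_congr rfl fun j _ =>
    Finset.sum_congr rfl fun l _ => by ring

lemma tri_const_mul (τ : Fin 3 → Fin 3 → Fin 3 → K) (a : K) (x y z : Fin 3 → K) :
    tri (fun i j l => a * τ i j l) x y z = a * tri τ x y z := by
  simp only [tri, Finset.mul_sum, mul_assoc]

lemma tri_mulVec (τ : Fin 3 → Fin 3 → Fin 3 → K) (M : Matrix (Fin 3) (Fin 3) K)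
    (x y z : Fin 3 → K) : tri τ (M.mulVec x) (M.mulVec y) (M.mulVec z)
      = tri (fun i j l => tri τ (fun a => M a i) (fun a => M a j) (fun a => M a l)) x y z := by
  have h₁ : ∀ y z, tri τ (M.mulVec x) y z = ∑ i, tri τ (fun a => M a i) y z * x i := fun y z => by
    simp only [tri, Matrix.mulVec, dotProduct, Fin.sum_univ_three]
    ring
  have h₂ : ∀ w z, tri τ w (M.mulVec y) z = ∑ i, tri τ w (fun a => M a i) z * y i := fun w z => by
    simp only [tri, Matrix.mulVec, dotProduct, Fin.sum_univ_three]
    ring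
  have h₃ : ∀ w y, tri τ w y (M.mulVec z) = ∑ i, tri τ w y (fun a => M a i) * z i := fun w y => by
    simp only [tri, Matrix.mulVec, dotProduct, Fin.sum_univ_three]
    ring
  rw [h₁]
  simp only [h₂, h₃, Finset.sum_mul]
  refine Finset.sum_congr rfl fun i _ => Finset.sum_congr rfl fun j _ =>
    Finset.sum_congr rfl fun l _ => by ring

/-- The matrix of the bilinear form `(u, y) ↦ tri τ u y z`. -/
def lastMat (τ : Fin 3 → Fin 3 → Fin 3 → K) (z : Fin 3 → K) : Matrix (Fin 3) (Fin 3) K :=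
  Matrix.of fun u y => ∑ l, τ u y l * z l

/-- The matrix of the bilinear form `(u, y) ↦ tri τ v y u`. -/
def firstMat (τ : Fin 3 → Fin 3 → Fin 3 → K) (v : Fin 3 → K) : Matrix (Fin 3) (Fin 3) K :=
  Matrix.of fun u y => ∑ i, τ i y u * v i

lemma dot_lastMat (τ : Fin 3 → Fin 3 → Fin 3 → K) (u y z : Fin 3 → K) :
    u ⬝ᵥ (lastMat τ z).mulVec y = tri τ u y z := by
  simp [lastMat, tri, dotProduct, Matrix.mulVec, Fin.sum_univ_three]
  ring

lemma dot_firstMat (τ : Fin 3 → Fin 3 → Fin 3 → K) (u y v : Fin 3 → K) :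
    u ⬝ᵥ (firstMat τ v).mulVec y = tri τ v y u := by
  simp [firstMat, tri, dotProduct, Matrix.mulVec, Fin.sum_univ_three]
  ring

open Matrix in
lemma two_det_smul_eq (M N : Matrix (Fin 3) (Fin 3) K) :
    (2 * M.det) • N = (mixAdj M N * M).trace • M - (2 : K) • (M * mixAdj M N * M) := by
  ext i j
  fin_cases i <;> fin_cases j <;>
  · simp [mixAdj, Matrix.det_fin_three, Matrix.trace, Matrix.mul_apply, Fin.sum_univ_three]
    ring

open Matrix in
lemma two_det_mul_dot {M N : Matrix (Fin 3) (Fin 3) K} {q : K} {v z e : Fin 3 → K}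
    (h : mixAdj M N = -(q • vecMulVec v z + vecMulVec e v)) (u x : Fin 3 → K) :
    2 * M.det * (u ⬝ᵥ N *ᵥ x) =
      -(q * (z ⬝ᵥ M *ᵥ v) + v ⬝ᵥ M *ᵥ e) * (u ⬝ᵥ M *ᵥ x)
        + 2 * q * (u ⬝ᵥ M *ᵥ v) * (z ⬝ᵥ M *ᵥ x) + 2 * (u ⬝ᵥ M *ᵥ e) * (v ⬝ᵥ M *ᵥ x) := by
  have key := congrArg (fun A => u ⬝ᵥ A *ᵥ x) (two_det_smul_eq M N)
  simp only [h, smul_mulVec, dotProduct_smul, smul_eq_mul, sub_mulVec, dotProduct_sub, mul_neg,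
    neg_mul, mul_add, add_mul, trace_neg, trace_add, Matrix.mul_smul, Matrix.smul_mul, trace_smul,
    mul_vecMulVec, vecMulVec_mul, trace_vecMulVec, neg_mulVec, add_mulVec, vecMulVec_mulVec,
    dotProduct_neg, dotProduct_add, dotProduct_smul, op_smul_eq_smul, smul_eq_mul] at key
  rw [dotProduct_comm v, dotProduct_comm e, ← dotProduct_mulVec, ← dotProduct_mulVec] at key
  simp only [← dotProduct_mulVec] at key
  linear_combination key

/-- Cofactor-type annihilation for a rank one matrix. -/
lemma mixAdj_mulVec_eq_zero (f r : Fin 3 → K) (N : Matrix (Fin 3) (Fin 3) K) :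
    (mixAdj (Matrix.vecMulVec f r) N).mulVec f = 0 := by
  ext c
  simp [mixAdj, Matrix.mulVec, dotProduct, Fin.sum_univ_three, Matrix.vecMulVec]
  ring

open Matrix in
lemma mixAdj_lastMat_firstMat {τ τ' : Fin 3 → Fin 3 → Fin 3 → K} {q : K}
    {E : Matrix (Fin 3) (Fin 3) K}
    (hA : ∀ i l c k, mixAdj (Matrix.of fun u y => τ u y l) (Matrix.of fun u y => τ' i y u) c k
      = -(q * (1 : Matrix (Fin 3) (Fin 3) K) c i * (1 : Matrix (Fin 3) (Fin 3) K) l k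
        + (1 : Matrix (Fin 3) (Fin 3) K) i k * E c l)) (z v : Fin 3 → K) :
    mixAdj (lastMat τ z) (firstMat τ' v) = -(q • vecMulVec v z + vecMulVec (E *ᵥ z) v) := by
  ext c k
  have h : mixAdj (lastMat τ z) (firstMat τ' v) c k = ∑ i, ∑ l, v i * z l *
      mixAdj (Matrix.of fun u y => τ u y l) (Matrix.of fun u y => τ' i y u) c k := by
    simp only [mixAdj, lastMat, firstMat, Matrix.of_apply, Fin.sum_univ_three]
    ring
  simp only [h, hA, Matrix.neg_apply, Matrix.add_apply, Matrix.smul_apply, vecMulVec_apply, mulVec,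
    dotProduct, Fin.sum_univ_three, smul_eq_mul, one_apply]
  fin_cases c <;> fin_cases k <;> simp <;> ring

section Proportional

variable {τ τ' : Fin 3 → Fin 3 → Fin 3 → K} {q : K} {E : Matrix (Fin 3) (Fin 3) K}

lemma tri_swap (hsym : ∀ i j l, τ i j l + τ j i l = τ i l j + τ j l i) (h2 : (2 : K) ≠ 0)
    (x z : Fin 3 → K) : tri τ x z x = tri τ x x z := by
  refine mul_left_cancel₀ h2 ?_
  have h : ∑ i, ∑ j, ∑ l, (τ i j l + τ j i l) * x i * x j * z l
      = ∑ i, ∑ j, ∑ l, (τ i l j + τ j l i) * x i * x j * z l :=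
    Finset.sum_congr rfl fun i _ => Finset.sum_congr rfl fun j _ =>
      Finset.sum_congr rfl fun l _ => by rw [hsym]
  simp only [tri, Fin.sum_univ_three] at h ⊢
  linear_combination (-1 : K) * h

open Matrix in
lemma two_det_mul_tri (h2 : (2 : K) ≠ 0)
    (hsym : ∀ i j l, τ i j l + τ j i l = τ i l j + τ j l i)
    (hA : ∀ z v, mixAdj (lastMat τ z) (firstMat τ' v)
      = -(q • vecMulVec v z + vecMulVec (E *ᵥ z) v)) (u x z : Fin 3 → K) :
    2 * (lastMat τ z).det * tri τ' x x u = 2 * tri τ u (E *ᵥ z) z * tri τ x x z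
      + (q * tri τ z z x - tri τ x (E *ᵥ z) z) * tri τ u x z := by
  have h := two_det_mul_dot (hA z x) u x
  simp only [dot_lastMat, dot_firstMat] at h
  rw [tri_swap hsym h2 z x] at h
  linear_combination h

lemma tri_eq_of_det_mul_eq_zero [Infinite K] (h2 : (2 : K) ≠ 0)
    (hsym : ∀ i j l, τ i j l + τ j i l = τ i l j + τ j l i)
    (hA : ∀ z v, mixAdj (lastMat τ z) (firstMat τ' v)
      = -(q • Matrix.vecMulVec v z + Matrix.vecMulVec (E.mulVec z) v)) {z x₀ : Fin 3 → K}
    (hx₀ : tri τ x₀ x₀ z ≠ 0) (hz : ∀ x, (lastMat τ z).det * tri τ' x x x = 0)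
    (x : Fin 3 → K) : tri τ x (E.mulVec z) z = -q * tri τ z z x := by
  have hz' : ∀ x, (q * tri τ z z x + tri τ x (E.mulVec z) z) * tri τ x x z = 0 := fun x => by
    linear_combination 2 * hz x - two_det_mul_tri h2 hsym hA x x z
  by_contra hx
  obtain ⟨y, hy⟩ := IsPolyFun.exists_mul_ne_zero
    (f := fun x => q * tri τ z z x + tri τ x (E.mulVec z) z) (g := fun x => tri τ x x z)
    (((IsPolyFun.const q).mul (isPolyFun_tri_right τ z z)).add (isPolyFun_tri_left τ _ z))
    (isPolyFun_tri_diag τ z)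
    ⟨x, fun h => hx (by linear_combination h)⟩ ⟨x₀, hx₀⟩
  exact hy (hz' y)

lemma exists_tri_ne_zero_of_tri_ne_zero [Infinite K] {x₁ u₁ : Fin 3 → K}
    (h₁ : tri τ x₁ x₁ u₁ ≠ 0) : ∃ z, tri τ x₁ x₁ z * tri τ z z u₁ ≠ 0 :=
  IsPolyFun.exists_mul_ne_zero
    (isPolyFun_tri_right τ x₁ x₁) (isPolyFun_tri_diag τ u₁) ⟨u₁, h₁⟩ ⟨x₁, h₁⟩

/-- A vector `f` with `v ⬝ f = 0 → q (z ⬝ f) v + (v ⬝ f) e = 0` for all `v`. -/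
lemma eq_zero_of_forall_smul (hq : q ≠ 0) {z e f : Fin 3 → K} (hf : f ≠ 0)
    (h : ∀ v : Fin 3 → K, (q * z ⬝ᵥ f) • v + (v ⬝ᵥ f) • e = 0) : z ⬝ᵥ f = 0 ∧ e = 0 := by
  have hz : z ⬝ᵥ f = 0 := by
    by_contra hz
    refine hf (funext fun i => ?_)
    have h0 := h ![f 1, -f 0, 0]
    have h1 := h ![f 2, 0, -f 0]
    have e0 : ![f 1, -f 0, 0] ⬝ᵥ f = 0 := by simp [dotProduct, Fin.sum_univ_three]; ring
    have e1 : ![f 2, 0, -f 0] ⬝ᵥ f = 0 := by simp [dotProduct, Fin.sum_univ_three]; ring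
    rw [e0, zero_smul, add_zero, smul_eq_zero, or_iff_right (mul_ne_zero hq hz)] at h0
    rw [e1, zero_smul, add_zero, smul_eq_zero, or_iff_right (mul_ne_zero hq hz)] at h1
    fin_cases i
    · simpa using congrFun h0 1
    · simpa using congrFun h0 0
    · simpa using congrFun h1 0
  refine ⟨hz, ?_⟩
  obtain ⟨i, hi⟩ := Function.ne_iff.1 hf
  simpa [hz, show f i ≠ 0 from hi] using h (Pi.single i 1)

lemma exists_det_lastMat_ne_zero [Infinite K] (h2 : (2 : K) ≠ 0) (hq : q ≠ 0)
    (hsym : ∀ i j l, τ i j l + τ j i l = τ i l j + τ j l i)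
    (hA : ∀ z v, mixAdj (lastMat τ z) (firstMat τ' v)
      = -(q • Matrix.vecMulVec v z + Matrix.vecMulVec (E.mulVec z) v)) {x₁ u₁ : Fin 3 → K}
    (h₁ : tri τ x₁ x₁ u₁ ≠ 0) : ∃ z, (lastMat τ z).det ≠ 0 := by
  by_contra! hD
  obtain ⟨z, hz⟩ := exists_tri_ne_zero_of_tri_ne_zero h₁
  obtain ⟨hx₁, hu₁⟩ := mul_ne_zero_iff.1 hz
  have hE := tri_eq_of_det_mul_eq_zero h2 hsym hA hx₁ (fun x => by simp [hD])
  have hfac : ∀ u x, tri τ z z x * tri τ u x z = tri τ z z u * tri τ x x z := fun u x => by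
    refine mul_left_cancel₀ (mul_ne_zero h2 hq) ?_
    have h := two_det_mul_tri h2 hsym hA u x z
    rw [hE, hE, hD] at h
    linear_combination -h
  have hrank : ∀ x, ∃ ρ, ∀ u, tri τ u x z = tri τ z z u * ρ := by
    have hne : ∀ x, tri τ z z x ≠ 0 → ∃ ρ, ∀ u, tri τ u x z = tri τ z z u * ρ := fun x hx =>
      ⟨tri τ x x z / tri τ z z x, fun u => by
        have := hfac u x
        field_simp
        linear_combination this⟩
    intro x
    by_cases hx : tri τ z z x = 0
    · obtain ⟨ρ₁, hρ₁⟩ := hne u₁ hu₁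
      obtain ⟨ρ₂, hρ₂⟩ := hne (x + u₁) (by rwa [tri_add_right, hx, zero_add])
      exact ⟨ρ₂ - ρ₁, fun u => by
        have := tri_add_mid τ u x u₁ z
        linear_combination hρ₂ u - hρ₁ u - this⟩
    · exact hne x hx
  choose ρ hρ using hrank
  set f : Fin 3 → K := fun i => tri τ z z (Pi.single i 1) with hf
  have hdot : ∀ v, v ⬝ᵥ f = tri τ z z v := fun v => by
    simp [hf, tri, dotProduct, Fin.sum_univ_three]
    ring
  have hM : lastMat τ z = Matrix.vecMulVec f fun j => ρ (Pi.single j 1) := by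
    ext i j
    rw [Matrix.vecMulVec_apply, ← hρ, ← dot_lastMat]
    simp
  have hf0 : f ≠ 0 := fun h => hu₁ (by rw [← hdot, h, dotProduct_zero])
  have hz0 := eq_zero_of_forall_smul (q := q) (z := z) (e := E.mulVec z) hq hf0 fun v => by
    have h := congrArg (fun A => A.mulVec f) (hA z v)
    simp only [hM, mixAdj_mulVec_eq_zero] at h
    simp only [Matrix.neg_mulVec, Matrix.add_mulVec, Matrix.smul_mulVec,
      Matrix.vecMulVec_mulVec, op_smul_eq_smul] at h
    rw [mul_smul]
    exact neg_eq_zero.1 h.symm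
  have := hE u₁
  rw [hz0.2] at this
  have h0 : tri τ u₁ 0 z = 0 := by simp [tri]
  rw [h0] at this
  exact mul_ne_zero (neg_ne_zero.2 hq) hu₁ this.symm

lemma isPolyFun_det_lastMat : IsPolyFun fun z => (lastMat τ z).det := by
  have h : ∀ i j, IsPolyFun fun z => lastMat τ z i j := fun i j =>
    IsPolyFun.sum Finset.univ fun l => (IsPolyFun.const (τ i j l)).mul (.coord l)
  simp only [Matrix.det_apply]
  refine IsPolyFun.sum _ fun σ => ?_
  have := (IsPolyFun.const ((Equiv.Perm.sign σ : ℤ) : K)).mul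
    (IsPolyFun.prod Finset.univ fun i => h (σ i) i)
  simpa [Units.smul_def, zsmul_eq_mul] using this

lemma exists_poly_det_lastMat (z₀ z₁ : Fin 3 → K) :
    ∃ P : Polynomial K, ∀ s, P.eval s = (lastMat τ (z₀ + s • z₁)).det := by
  refine ⟨(Matrix.of fun i j => Polynomial.C (lastMat τ z₀ i j)
    + Polynomial.X * Polynomial.C (lastMat τ z₁ i j)).det, fun s => ?_⟩
  rw [← Polynomial.coe_evalRingHom, RingHom.map_det]
  congr 1
  ext i j
  simp [lastMat, Fin.sum_univ_three]
  ring

lemma exists_smul_eq_of_det_ne_zero [Infinite K] (h2 : (2 : K) ≠ 0)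
    (hsym : ∀ i j l, τ i j l + τ j i l = τ i l j + τ j l i)
    (hA : ∀ z v, mixAdj (lastMat τ z) (firstMat τ' v)
      = -(q • Matrix.vecMulVec v z + Matrix.vecMulVec (E.mulVec z) v)) {z₀ x₀ : Fin 3 → K}
    (hz₀ : (lastMat τ z₀).det ≠ 0) (hx₀ : tri τ' x₀ x₀ x₀ ≠ 0) (z : Fin 3 → K) :
    ∃ a, ∀ x, tri τ x x z = a * tri τ x x z₀ := by
  classical
  have hdvd : ∀ z x, tri τ x x z = 0 → (lastMat τ z).det * tri τ' x x x = 0 := fun z x hx => by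
    refine mul_left_cancel₀ h2 ?_
    have h := two_det_mul_tri h2 hsym hA x x z
    rw [hx] at h
    linear_combination h
  by_contra! hz
  obtain ⟨P, hP⟩ := exists_poly_det_lastMat (τ := τ) z₀ z
  have hP0 : P ≠ 0 := fun h => hz₀ (by simpa [h] using (hP 0).symm)
  have hline : ∀ s x, tri τ x x (z₀ + s • z) = tri τ x x z₀ + s * tri τ x x z := fun s x => by
    rw [tri_add_right, tri_smul_right]
  have hne : ∀ s : K, ∃ x, tri τ x x (z₀ + s • z) ≠ 0 := fun s => by
    by_contra! h
    by_cases hs : s = 0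
    · subst hs
      exact (mul_ne_zero hz₀ hx₀) (hdvd z₀ x₀ (by simpa using h x₀))
    · obtain ⟨x, hx⟩ := hz (-s⁻¹)
      refine hx ?_
      have := h x
      rw [hline] at this
      field_simp
      linear_combination this
  obtain ⟨x₁, hx₁⟩ := hz 0
  rw [zero_mul] at hx₁
  obtain ⟨y, hy⟩ := IsPolyFun.exists_mul_ne_zero
    (IsPolyFun.prod P.roots.toFinset fun s => isPolyFun_tri_diag τ (z₀ + s • z))
    ((isPolyFun_tri_diag τ z).mul (isPolyFun_tri_cube τ'))
    (IsPolyFun.exists_prod_ne_zero _ (fun s => isPolyFun_tri_diag τ (z₀ + s • z))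
      fun s _ => hne s)
    ((isPolyFun_tri_diag τ z).exists_mul_ne_zero (isPolyFun_tri_cube τ') ⟨x₁, hx₁⟩ ⟨x₀, hx₀⟩)
  obtain ⟨hprod, hy'⟩ := mul_ne_zero_iff.1 hy
  obtain ⟨hyz, hyc⟩ := mul_ne_zero_iff.1 hy'
  set s := -(tri τ y y z₀ / tri τ y y z) with hs
  have hs0 : tri τ y y (z₀ + s • z) = 0 := by
    rw [hline, hs]
    field_simp
    ring
  have hroot : s ∈ P.roots.toFinset := by
    rw [Multiset.mem_toFinset, Polynomial.mem_roots hP0, Polynomial.IsRoot, hP]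
    exact (mul_eq_zero.1 (hdvd _ _ hs0)).resolve_right hyc
  exact Finset.prod_ne_zero_iff.1 hprod s hroot hs0

/-- If the mixed adjugates of the slices of `τ` and of its transform `τ'` have the form prescribed
by the braid equation, then the covectors `tri τ x x` are pairwise proportional. -/
theorem tri_diag_proportional [Infinite K] (h2 : (2 : K) ≠ 0) (hq : q ≠ 0)
    (hsym : ∀ i j l, τ i j l + τ j i l = τ i l j + τ j l i)
    (hA : ∀ z v, mixAdj (lastMat τ z) (firstMat τ' v)
      = -(q • Matrix.vecMulVec v z + Matrix.vecMulVec (E.mulVec z) v))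
    {κ : K} (hκ : κ ≠ 0) {g : (Fin 3 → K) → (Fin 3 → K)} (hg : Function.Surjective g)
    (hτ' : ∀ x y z, tri τ' x y z = κ * tri τ (g x) (g y) (g z)) (x y u v : Fin 3 → K) :
    tri τ x x u * tri τ y y v = tri τ x x v * tri τ y y u := by
  by_contra hne
  obtain ⟨x₁, u₁, h₁⟩ : ∃ x₁ u₁, tri τ x₁ x₁ u₁ ≠ 0 := by
    by_contra! h
    exact hne (by simp [h])
  obtain ⟨z₀, hz₀⟩ := exists_det_lastMat_ne_zero h2 hq hsym hA h₁
  by_cases hc : ∀ x, tri τ x x x = 0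
  · obtain ⟨x₂, rfl⟩ := hg x₁
    obtain ⟨u₂, rfl⟩ := hg u₁
    have h₂ : tri τ' x₂ x₂ u₂ ≠ 0 := by
      rw [hτ']
      exact mul_ne_zero hκ h₁
    obtain ⟨z, hz⟩ := (isPolyFun_det_lastMat (τ := τ)).exists_mul_ne_zero
      ((isPolyFun_tri_right τ (g x₂) (g x₂)).mul (isPolyFun_tri_diag τ' u₂)) ⟨z₀, hz₀⟩
      ((isPolyFun_tri_right τ (g x₂) (g x₂)).exists_mul_ne_zero (isPolyFun_tri_diag τ' u₂)
        ⟨_, h₁⟩ ⟨_, h₂⟩)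
    obtain ⟨hD, hz'⟩ := mul_ne_zero_iff.1 hz
    obtain ⟨hQ, hQ'⟩ := mul_ne_zero_iff.1 hz'
    have hE := tri_eq_of_det_mul_eq_zero h2 hsym hA hQ (fun x => by simp [hτ', hc])
    have h := two_det_mul_tri h2 hsym hA u₂ z z
    rw [hE z, hc] at h
    exact mul_ne_zero (mul_ne_zero h2 hD) hQ' (by linear_combination h)
  · push Not at hc
    obtain ⟨w, hw⟩ := hc
    obtain ⟨x₀, rfl⟩ := hg w
    have hx₀ : tri τ' x₀ x₀ x₀ ≠ 0 := by
      rw [hτ']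
      exact mul_ne_zero hκ hw
    obtain ⟨a, ha⟩ := exists_smul_eq_of_det_ne_zero h2 hsym hA hz₀ hx₀ u
    obtain ⟨b, hb⟩ := exists_smul_eq_of_det_ne_zero h2 hsym hA hz₀ hx₀ v
    exact hne (by rw [ha, hb, ha, hb]; ring)

end Proportional

end Core
section Bridge

variable {k V}

lemma op12_tmul (R : V ⊗[k] V →ₗ[k] V ⊗[k] V) (w : V ⊗[k] V) (z : V) :
    op12 k V R (TensorProduct.assoc k V V V (w ⊗ₜ z)) =
      TensorProduct.assoc k V V V (R w ⊗ₜ z) := by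
  simp [op12]

lemma op12_skewY (q : k) (R : V ⊗[k] V →ₗ[k] V ⊗[k] V) :
    op12 k V (skewY k V q R) = q • LinearMap.id - op12 k V R := by
  refine TensorProduct.ext_threefold' ?_
  intro x y z
  simp [op12, skewY]

lemma op23_skewY (q : k) (R : V ⊗[k] V →ₗ[k] V ⊗[k] V) :
    op23 k V (skewY k V q R) = q • LinearMap.id - op23 k V R := by
  simp [op23, skewY, LinearMap.lTensor_sub, LinearMap.lTensor_smul]

lemma op12_comp (R S : V ⊗[k] V →ₗ[k] V ⊗[k] V) :
    op12 k V (R ∘ₗ S) = op12 k V R ∘ₗ op12 k V S := by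
  ext
  simp [op12]

lemma skewY_braid {A : Type} [Ring A] [Algebra k A] {q : k} {a b : A}
    (hab : a * (b * a) = b * (a * b)) (ha : a * a = (q - 1) • a + q • 1)
    (hb : b * b = (q - 1) • b + q • 1) :
    (q • 1 - a) * (q • 1 - b) * (q • 1 - a) - q • (q • 1 - a)
      = (q • 1 - b) * (q • 1 - a) * (q • 1 - b) - q • (q • 1 - b) := by
  simp only [mul_sub, sub_mul, smul_mul_assoc, mul_smul_comm, mul_one, one_mul, mul_assoc, hab,
    ha, hb]
  module

lemma IsHeckeSymmetry.mul_self {q : k} {R : V ⊗[k] V →ₗ[k] V ⊗[k] V}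
    (hR : IsHeckeSymmetry k V q R) (w : V ⊗[k] V) : R (R w) = (q - 1) • R w + q • w := by
  have h : R (R w + w) - q • (R w + w) = 0 := LinearMap.congr_fun hR.2.2 w
  rw [map_add, sub_eq_zero] at h
  rw [eq_sub_of_add_eq h]
  module

lemma IsHeckeSymmetry.skewY_braid {q : k} {R : V ⊗[k] V →ₗ[k] V ⊗[k] V}
    (hR : IsHeckeSymmetry k V q R) (t : V ⊗[k] (V ⊗[k] V)) :
    op12 k V (skewY k V q R) (op23 k V (skewY k V q R) (op12 k V (skewY k V q R) t))
        - q • op12 k V (skewY k V q R) t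
      = op23 k V (skewY k V q R) (op12 k V (skewY k V q R) (op23 k V (skewY k V q R) t))
        - q • op23 k V (skewY k V q R) t := by
  have hRR : R ∘ₗ R = (q - 1) • R + q • LinearMap.id := LinearMap.ext hR.mul_self
  have h1 : op12 k V R * op12 k V R = (q - 1) • op12 k V R + q • 1 := by
    rw [Module.End.mul_eq_comp, ← op12_comp, hRR]
    refine TensorProduct.ext_threefold' ?_
    intro x y z
    simp [op12]
  have h2 : op23 k V R * op23 k V R = (q - 1) • op23 k V R + q • 1 := by
    rw [Module.End.mul_eq_comp, op23, ← LinearMap.lTensor_comp, hRR]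
    simp [LinearMap.lTensor_add, LinearMap.lTensor_smul]
    rfl
  have h := LinearMap.congr_fun
    (_root_.skewY_braid (q := q) (A := Module.End k (V ⊗[k] (V ⊗[k] V)))
      hR.2.1 h1 h2) t
  rw [op12_skewY, op23_skewY]
  exact h

lemma skewY_skewY {q : k} {R : V ⊗[k] V →ₗ[k] V ⊗[k] V} (hR : IsHeckeSymmetry k V q R)
    (w : V ⊗[k] V) : skewY k V q R (skewY k V q R w) = (1 + q) • skewY k V q R w := by
  simp only [skewY, LinearMap.sub_apply, LinearMap.smul_apply, LinearMap.id_apply, map_sub,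
    map_smul, hR.mul_self]
  module

lemma wedge31_wedge2 (ζ : V ≃ₗ[k] V) (x y z : V) :
    wedge31 k V ζ x (wedge2 k V ζ y z) = wedge3 k V ζ x y z := by
  simp [wedge31, wedge2, wedge3, TensorProduct.tmul_sub]
  abel

lemma alternating_apply_three (ω : AlternatingMap k V k (Fin 3)) (b : Module.Basis (Fin 3) k V)
    (x y z : V) : ω ![x, y, z] = ω b * Matrix.det (Matrix.of ![b.repr x, b.repr y, b.repr z]) := by
  conv_lhs => rw [ω.eq_smul_basis_det b]
  simp [Module.Basis.det_apply, Matrix.det_fin_three, Module.Basis.toMatrix_apply]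
  left
  ring

lemma smul_eq_sum_wedge2 {ζ : V ≃ₗ[k] V} {ω : AlternatingMap k V k (Fin 3)}
    {Ω : V ⊗[k] (V ⊗[k] V) →ₗ[k] k}
    (hΩ : ∀ x y z : V, Ω (wedge3 k V ζ x y z) = ω ![x, y, z]) (b : Module.Basis (Fin 3) k V)
    {w : V ⊗[k] V} (hw : w ∈ Ups2 k V ζ) :
    ω b • w = ∑ i, Ω (wedge31 k V ζ (b i) w) • wedge2 k V ζ (b (i + 1)) (b (i + 2)) := by
  refine Submodule.span_induction (p := fun w _ => ω b • w =
    ∑ i, Ω (wedge31 k V ζ (b i) w) • wedge2 k V ζ (b (i + 1)) (b (i + 2))) ?_ ?_ ?_ ?_ hw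
  · rintro _ ⟨x, y, rfl⟩
    simp only [wedge31_wedge2, hΩ, alternating_apply_three ω b, Matrix.det_fin_three]
    have hx := b.sum_repr x
    have hy := b.sum_repr y
    simp only [Fin.sum_univ_three] at hx hy ⊢
    conv_lhs => rw [← hx, ← hy]
    simp [wedge2, TensorProduct.add_tmul, TensorProduct.tmul_add, ← TensorProduct.smul_tmul']
    module
  · simp
  · intro w w' _ _ h h'
    simp [smul_add, h, h', add_smul, Finset.sum_add_distrib]
  · intro a w _ h
    simp only [map_smul, smul_assoc, ← Finset.smul_sum, ← h]
    exact smul_comm _ _ _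

/-- The basis of `V ⊗ V ⊗ V` adapted to the twisted wedge products. -/
def twistBasis (ζ : V ≃ₗ[k] V) (b : Module.Basis (Fin 3) k V) :
    Module.Basis (Fin 3 × Fin 3 × Fin 3) k (V ⊗[k] (V ⊗[k] V)) :=
  ((b.map ζ).map ζ).tensorProduct ((b.map ζ).tensorProduct b)

lemma twistBasis_repr_tmul (ζ : V ≃ₗ[k] V) (b : Module.Basis (Fin 3) k V) (x y z : V)
    (m n l : Fin 3) : (twistBasis ζ b).repr (x ⊗ₜ (y ⊗ₜ z)) (m, n, l)
      = b.repr (ζ.symm (ζ.symm x)) m * (b.repr (ζ.symm y) n * b.repr z l) := by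
  simp [twistBasis]
  ring

lemma twistBasis_repr_op12 {ζ : V ≃ₗ[k] V} {Y : V ⊗[k] V →ₗ[k] V ⊗[k] V}
    (hY : LinearMap.range Y = Ups2 k V ζ) (b : Module.Basis (Fin 3) k V) (m n l : Fin 3)
    (t : V ⊗[k] (V ⊗[k] V)) :
    (twistBasis ζ b).repr (op12 k V Y t) (m, n, l)
      = -(twistBasis ζ b).repr (op12 k V Y t) (n, m, l) := by
  have key : ∀ w ∈ Ups2 k V ζ, ∀ z,
      (twistBasis ζ b).repr (TensorProduct.assoc k V V V (w ⊗ₜ z)) (m, n, l)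
        = -(twistBasis ζ b).repr (TensorProduct.assoc k V V V (w ⊗ₜ z)) (n, m, l) := by
    intro w hw z
    induction hw using Submodule.span_induction with
    | mem w hw =>
      obtain ⟨x, y, rfl⟩ := hw
      simp [wedge2, TensorProduct.sub_tmul, twistBasis_repr_tmul]
      ring
    | zero => simp
    | add w w' _ _ h h' =>
      simp only [TensorProduct.add_tmul, map_add, Finsupp.add_apply, h, h']
      ring
    | smul a w _ h =>
      simp only [← TensorProduct.smul_tmul', map_smul, Finsupp.smul_apply, h, smul_neg]
  obtain ⟨t, rfl⟩ := (TensorProduct.assoc k V V V).surjective t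
  induction t using TensorProduct.induction_on with
  | zero => simp
  | tmul w z =>
    rw [op12_tmul]
    exact key _ (hY ▸ LinearMap.mem_range_self Y w) z
  | add t t' h h' =>
    simp only [map_add, Finsupp.add_apply, h, h']
    ring

lemma twistBasis_repr_op23 {ζ : V ≃ₗ[k] V} {Y : V ⊗[k] V →ₗ[k] V ⊗[k] V}
    (hY : LinearMap.range Y = Ups2 k V ζ) (b : Module.Basis (Fin 3) k V) (m n l : Fin 3)
    (t : V ⊗[k] (V ⊗[k] V)) :
    (twistBasis ζ b).repr (op23 k V Y t) (m, n, l)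
      = -(twistBasis ζ b).repr (op23 k V Y t) (m, l, n) := by
  have key : ∀ w ∈ Ups2 k V ζ, ∀ x,
      (twistBasis ζ b).repr (x ⊗ₜ w) (m, n, l) = -(twistBasis ζ b).repr (x ⊗ₜ w) (m, l, n) := by
    intro w hw z
    induction hw using Submodule.span_induction with
    | mem w hw =>
      obtain ⟨x, y, rfl⟩ := hw
      simp [wedge2, TensorProduct.tmul_sub, twistBasis_repr_tmul]
      ring
    | zero => simp
    | add w w' _ _ h h' =>
      simp only [TensorProduct.tmul_add, map_add, Finsupp.add_apply, h, h']
      ring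
    | smul a w _ h =>
      simp only [TensorProduct.tmul_smul, map_smul, Finsupp.smul_apply, h, smul_neg]
  induction t using TensorProduct.induction_on with
  | zero => simp
  | tmul x w => exact key _ (hY ▸ LinearMap.mem_range_self Y w) x
  | add t t' h h' =>
    simp only [map_add, Finsupp.add_apply, h, h']
    ring

lemma alternating_coeff_eq (h2 : (2 : k) ≠ 0) {f : Fin 3 → Fin 3 → Fin 3 → k}
    (h12 : ∀ m n l, f m n l = -f n m l) (h23 : ∀ m n l, f m n l = -f m l n) (i l : Fin 3) :
    f (i + 1) (i + 2) l = (1 : Matrix (Fin 3) (Fin 3) k) i l * f 0 1 2 := by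
  have h0 : ∀ {a : k}, a = -a → a = 0 := fun {a} h =>
    (mul_eq_zero.1 (by linear_combination h : 2 * a = 0)).resolve_left h2
  have hl : ∀ m n, f m n n = 0 := fun m n => h0 (h23 m n n)
  have hm : ∀ m n, f m n m = 0 := fun m n => by rw [h23, h0 (h12 m m n), neg_zero]
  fin_cases i <;> fin_cases l <;> simp [hl, hm]
  · rw [h23 1 2 0, h12 1 0 2, neg_neg]
  · rw [h12 2 0 1, h23 0 2 1, neg_neg]

/-- The coefficients of the trilinear form `ℓ_{xy}(z)` in the basis `b`, normalized by `ω`. -/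
def ellCoeff (ζ : V ≃ₗ[k] V) (q : k) (R : V ⊗[k] V →ₗ[k] V ⊗[k] V)
    (Ω : V ⊗[k] (V ⊗[k] V) →ₗ[k] k) (ω : AlternatingMap k V k (Fin 3))
    (b : Module.Basis (Fin 3) k V) (i j l : Fin 3) : k :=
  ellF k V ζ q R Ω (b i) (b j) (b l) / ω b

lemma skewY_tmul {ζ : V ≃ₗ[k] V} {q : k} {R : V ⊗[k] V →ₗ[k] V ⊗[k] V}
    (hY : LinearMap.range (skewY k V q R) = Ups2 k V ζ) {ω : AlternatingMap k V k (Fin 3)}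
    {Ω : V ⊗[k] (V ⊗[k] V) →ₗ[k] k}
    (hΩ : ∀ x y z : V, Ω (wedge3 k V ζ x y z) = ω ![x, y, z]) {b : Module.Basis (Fin 3) k V}
    (hb : ω b ≠ 0) (j l : Fin 3) :
    skewY k V q R (ζ (b j) ⊗ₜ b l)
      = ∑ i, ellCoeff ζ q R Ω ω b i j l • wedge2 k V ζ (b (i + 1)) (b (i + 2)) := by
  have h := smul_eq_sum_wedge2 hΩ b
    (hY ▸ LinearMap.mem_range_self (skewY k V q R) (ζ (b j) ⊗ₜ b l))
  rw [← smul_right_injective _ hb |>.eq_iff, h, Finset.smul_sum]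
  refine Finset.sum_congr rfl fun i _ => ?_
  rw [smul_smul, ellCoeff, mul_div_cancel₀ _ hb]
  rfl

lemma ellF_sub_ellF {ζ : V ≃ₗ[k] V} {q : k} {R : V ⊗[k] V →ₗ[k] V ⊗[k] V}
    (hR : IsHeckeSymmetry k V q R)
    (hY : LinearMap.range (skewY k V q R) = Ups2 k V ζ) {ω : AlternatingMap k V k (Fin 3)}
    {Ω : V ⊗[k] (V ⊗[k] V) →ₗ[k] k}
    (hΩ : ∀ x y z : V, Ω (wedge3 k V ζ x y z) = ω ![x, y, z]) (x y z : V) :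
    ellF k V ζ q R Ω x y z - ellF k V ζ q R Ω x z y = (1 + q) * ω ![x, y, z] := by
  have hw : wedge2 k V ζ y z ∈ LinearMap.range (skewY k V q R) :=
    hY ▸ Submodule.subset_span ⟨y, z, rfl⟩
  obtain ⟨w, hw⟩ := hw
  calc ellF k V ζ q R Ω x y z - ellF k V ζ q R Ω x z y
      = Ω (wedge31 k V ζ x (skewY k V q R (wedge2 k V ζ y z))) := by
        simp only [ellF, ell, wedge2, map_sub]
        rfl
    _ = (1 + q) * ω ![x, y, z] := by
        rw [← hw, skewY_skewY hR, hw, map_smul, map_smul, wedge31_wedge2, hΩ, smul_eq_mul]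

lemma ellCoeff_symm {ζ : V ≃ₗ[k] V} {q : k} {R : V ⊗[k] V →ₗ[k] V ⊗[k] V}
    (hR : IsHeckeSymmetry k V q R)
    (hY : LinearMap.range (skewY k V q R) = Ups2 k V ζ) {ω : AlternatingMap k V k (Fin 3)}
    {Ω : V ⊗[k] (V ⊗[k] V) →ₗ[k] k}
    (hΩ : ∀ x y z : V, Ω (wedge3 k V ζ x y z) = ω ![x, y, z]) (b : Module.Basis (Fin 3) k V)
    (i j l : Fin 3) :
    ellCoeff ζ q R Ω ω b i j l + ellCoeff ζ q R Ω ω b j i l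
      = ellCoeff ζ q R Ω ω b i l j + ellCoeff ζ q R Ω ω b j l i := by
  have h : ω ![b i, b j, b l] = -ω ![b j, b i, b l] := by
    simp only [alternating_apply_three ω b, Matrix.det_fin_three, Matrix.of_apply,
      Matrix.cons_val_zero, Matrix.cons_val_one, Matrix.cons_val]
    ring
  have h1 := ellF_sub_ellF hR hY hΩ (b i) (b j) (b l)
  have h2 := ellF_sub_ellF hR hY hΩ (b j) (b i) (b l)
  simp only [ellCoeff, ← add_div]
  congr 1
  linear_combination h1 + h2 + (1 + q) * h

lemma twistBasis_repr_wedge2 (ζ : V ≃ₗ[k] V) (b : Module.Basis (Fin 3) k V) (i s l m : Fin 3) :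
    (twistBasis ζ b).repr (TensorProduct.assoc k V V V
        (wedge2 k V ζ (ζ (b (s + 1))) (ζ (b (s + 2))) ⊗ₜ b l)) (i + 1, i + 2, m)
      = (1 : Matrix (Fin 3) (Fin 3) k) i s * (1 : Matrix (Fin 3) (Fin 3) k) l m := by
  simp only [wedge2, TensorProduct.sub_tmul, map_sub, TensorProduct.assoc_tmul, Finsupp.sub_apply,
    twistBasis_repr_tmul, LinearEquiv.symm_apply_apply, Module.Basis.repr_self,
    Finsupp.single_apply, Matrix.one_apply]
  fin_cases i <;> fin_cases s <;> simp

lemma op12_skewY_tmul {ζ : V ≃ₗ[k] V} {q : k} {R : V ⊗[k] V →ₗ[k] V ⊗[k] V}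
    (hY : LinearMap.range (skewY k V q R) = Ups2 k V ζ) {ω : AlternatingMap k V k (Fin 3)}
    {Ω : V ⊗[k] (V ⊗[k] V) →ₗ[k] k}
    (hΩ : ∀ x y z : V, Ω (wedge3 k V ζ x y z) = ω ![x, y, z]) {b : Module.Basis (Fin 3) k V}
    (hb : ω (b.map ζ) ≠ 0) (i a s l m : Fin 3) :
    (twistBasis ζ b).repr (op12 k V (skewY k V q R) (ζ (ζ (b a)) ⊗ₜ (ζ (b s) ⊗ₜ b l)))
        (i + 1, i + 2, m)
      = ellCoeff ζ q R Ω ω (b.map ζ) i a s * (1 : Matrix (Fin 3) (Fin 3) k) l m := by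
  have h := skewY_tmul hY hΩ hb a s
  simp only [Module.Basis.map_apply] at h
  rw [← TensorProduct.assoc_tmul, op12_tmul, h]
  simp [TensorProduct.sum_tmul, ← TensorProduct.smul_tmul', twistBasis_repr_wedge2,
    Finsupp.finsetSum_apply, Matrix.one_apply]

lemma op12_op23_skewY_tmul {ζ : V ≃ₗ[k] V} {q : k} {R : V ⊗[k] V →ₗ[k] V ⊗[k] V}
    (hY : LinearMap.range (skewY k V q R) = Ups2 k V ζ) {ω : AlternatingMap k V k (Fin 3)}
    {Ω : V ⊗[k] (V ⊗[k] V) →ₗ[k] k}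
    (hΩ : ∀ x y z : V, Ω (wedge3 k V ζ x y z) = ω ![x, y, z]) {b : Module.Basis (Fin 3) k V}
    (hb : ω b ≠ 0) (hb' : ω (b.map ζ) ≠ 0) (i a j l m : Fin 3) :
    (twistBasis ζ b).repr (op12 k V (skewY k V q R) (op23 k V (skewY k V q R)
        (ζ (ζ (b a)) ⊗ₜ (ζ (b j) ⊗ₜ b l)))) (i + 1, i + 2, m)
      = ellCoeff ζ q R Ω ω b (m + 1) j l * ellCoeff ζ q R Ω ω (b.map ζ) i a (m + 2)
        - ellCoeff ζ q R Ω ω b (m + 2) j l * ellCoeff ζ q R Ω ω (b.map ζ) i a (m + 1) := by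
  rw [op23, LinearMap.lTensor_tmul, skewY_tmul hY hΩ hb]
  simp only [Fin.sum_univ_three, TensorProduct.tmul_add, map_add, TensorProduct.tmul_smul,
    map_smul, wedge2, TensorProduct.tmul_sub, map_sub, Finsupp.add_apply, Finsupp.smul_apply,
    Finsupp.sub_apply, op12_skewY_tmul hY hΩ hb', smul_eq_mul]
  fin_cases m <;> simp [Matrix.one_apply] <;> ring

lemma mixAdj_ellCoeff (h2 : (2 : k) ≠ 0) {ζ : V ≃ₗ[k] V} {q : k}
    {R : V ⊗[k] V →ₗ[k] V ⊗[k] V} (hR : IsHeckeSymmetry k V q R)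
    (hY : LinearMap.range (skewY k V q R) = Ups2 k V ζ) {ω : AlternatingMap k V k (Fin 3)}
    {Ω : V ⊗[k] (V ⊗[k] V) →ₗ[k] k}
    (hΩ : ∀ x y z : V, Ω (wedge3 k V ζ x y z) = ω ![x, y, z]) {b : Module.Basis (Fin 3) k V}
    (hb : ω b ≠ 0) (hb' : ω (b.map ζ) ≠ 0) :
    ∃ E : Matrix (Fin 3) (Fin 3) k, ∀ i l c m,
      mixAdj (Matrix.of fun u y => ellCoeff ζ q R Ω ω b u y l)
          (Matrix.of fun u y => ellCoeff ζ q R Ω ω (b.map ζ) i y u) c m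
        = -(q * (1 : Matrix (Fin 3) (Fin 3) k) c i * (1 : Matrix (Fin 3) (Fin 3) k) l m
          + (1 : Matrix (Fin 3) (Fin 3) k) i m * E c l) := by
  set Y := skewY k V q R
  let p : Fin 3 → V ⊗[k] V := fun c => wedge2 k V ζ (ζ (b (c + 1))) (ζ (b (c + 2)))
  let g : Fin 3 → Fin 3 → V ⊗[k] (V ⊗[k] V) := fun c l =>
    op12 k V Y (op23 k V Y (TensorProduct.assoc k V V V (p c ⊗ₜ b l)))
      - q • TensorProduct.assoc k V V V (p c ⊗ₜ b l)
  let f : Fin 3 → Fin 3 → Fin 3 → Fin 3 → Fin 3 → k := fun c l m n r =>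
    (twistBasis ζ b).repr (g c l) (m, n, r)
  have hg : ∀ c l, ∃ t, op12 k V Y t = g c l ∧ ∃ t', op23 k V Y t' = g c l := fun c l => by
    obtain ⟨w, hw⟩ : p c ∈ LinearMap.range Y := hY ▸ Submodule.subset_span ⟨_, _, rfl⟩
    have h1 : TensorProduct.assoc k V V V (p c ⊗ₜ b l)
        = op12 k V Y (TensorProduct.assoc k V V V (w ⊗ₜ b l)) := by rw [op12_tmul, hw]
    refine ⟨op23 k V Y (TensorProduct.assoc k V V V (p c ⊗ₜ b l))
      - q • TensorProduct.assoc k V V V (w ⊗ₜ b l), ?_,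
      op12 k V Y (op23 k V Y (TensorProduct.assoc k V V V (w ⊗ₜ b l)))
      - q • TensorProduct.assoc k V V V (w ⊗ₜ b l), ?_⟩
    · simp only [g, map_sub, map_smul, h1]
    · simp only [g, map_sub, map_smul, h1]
      exact (hR.skewY_braid _).symm
  have h12 : ∀ c l m n r, f c l m n r = -f c l n m r := fun c l m n r => by
    obtain ⟨t, ht, -⟩ := hg c l
    simp only [f, ← ht]
    exact twistBasis_repr_op12 hY b m n r t
  have h23 : ∀ c l m n r, f c l m n r = -f c l m r n := fun c l m n r => by
    obtain ⟨_, -, t, ht⟩ := hg c l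
    simp only [f, ← ht]
    exact twistBasis_repr_op23 hY b m n r t
  refine ⟨Matrix.of fun c l => f c l 0 1 2, fun i l c m => ?_⟩
  have key := alternating_coeff_eq h2 (h12 c l) (h23 c l) i m
  rw [Matrix.of_apply, ← key]
  have hp : ∀ c l, TensorProduct.assoc k V V V (p c ⊗ₜ b l)
      = ζ (ζ (b (c + 1))) ⊗ₜ (ζ (b (c + 2)) ⊗ₜ b l)
        - ζ (ζ (b (c + 2))) ⊗ₜ (ζ (b (c + 1)) ⊗ₜ b l) := fun c l => by
    simp [p, wedge2, TensorProduct.sub_tmul]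
  have h1 : (twistBasis ζ b).repr (TensorProduct.assoc k V V V (p c ⊗ₜ b l)) (i + 1, i + 2, m)
      = (1 : Matrix (Fin 3) (Fin 3) k) c i * (1 : Matrix (Fin 3) (Fin 3) k) l m := by
    rw [twistBasis_repr_wedge2]
    simp [Matrix.one_apply, eq_comm]
  simp only [f, g, map_sub, map_smul, Finsupp.sub_apply, Finsupp.smul_apply, h1, smul_eq_mul]
  simp only [hp, map_sub, Finsupp.sub_apply, Y, op12_op23_skewY_tmul hY hΩ hb hb', mixAdj,
    Matrix.of_apply]
  ring

/-- `ellF` as a trilinear map. -/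
def ellLin (ζ : V ≃ₗ[k] V) (q : k) (R : V ⊗[k] V →ₗ[k] V ⊗[k] V)
    (Ω : V ⊗[k] (V ⊗[k] V) →ₗ[k] k) : V →ₗ[k] V →ₗ[k] Module.Dual k V :=
  LinearMap.mk₂ k (ellF k V ζ q R Ω)
    (fun x x' y => by
      ext z
      simp only [ellF, ell, wedge31, LinearMap.comp_apply, LinearMap.add_apply,
        LinearMap.sub_apply, TensorProduct.mk_apply, LinearEquiv.coe_coe, LinearMap.flip_apply,
        map_add, map_sub, TensorProduct.map_add_right]
      ring)
    (fun a x y => by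
      ext z
      simp [ellF, ell, wedge31, TensorProduct.map_smul_right]
      ring)
    (fun x y y' => by
      ext z
      simp [ellF, ell])
    (fun a x y => by
      ext z
      simp [ellF, ell])

lemma ellF_eq_mul_tri (ζ : V ≃ₗ[k] V) (q : k) (R : V ⊗[k] V →ₗ[k] V ⊗[k] V)
    (Ω : V ⊗[k] (V ⊗[k] V) →ₗ[k] k) {ω : AlternatingMap k V k (Fin 3)}
    {b : Module.Basis (Fin 3) k V} (hb : ω b ≠ 0) (x y z : V) :
    ellF k V ζ q R Ω x y z
      = ω b * tri (ellCoeff ζ q R Ω ω b) (b.repr x) (b.repr y) (b.repr z) := by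
  have h : ellF k V ζ q R Ω x y z = ellLin ζ q R Ω (∑ i, b.repr x i • b i)
      (∑ i, b.repr y i • b i) (∑ i, b.repr z i • b i) := by
    simp only [b.sum_repr]
    rfl
  have hc : ∀ i j l, ellLin ζ q R Ω (b i) (b j) (b l) = ω b * ellCoeff ζ q R Ω ω b i j l :=
    fun i j l => (mul_div_cancel₀ _ hb).symm
  rw [h]
  simp only [Fin.sum_univ_three, map_add, map_smul, LinearMap.add_apply, LinearMap.smul_apply, hc,
    tri, smul_eq_mul]
  ring

lemma tri_ellCoeff_map (ζ : V ≃ₗ[k] V) (q : k) (R : V ⊗[k] V →ₗ[k] V ⊗[k] V)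
    (Ω : V ⊗[k] (V ⊗[k] V) →ₗ[k] k) {ω : AlternatingMap k V k (Fin 3)}
    {b : Module.Basis (Fin 3) k V} (hb : ω b ≠ 0) (i j l : Fin 3) :
    ellCoeff ζ q R Ω ω (b.map ζ) i j l = ω b / ω (b.map ζ) *
      tri (ellCoeff ζ q R Ω ω b) (fun a => LinearMap.toMatrix b b ζ a i)
        (fun a => LinearMap.toMatrix b b ζ a j) (fun a => LinearMap.toMatrix b b ζ a l) := by
  rw [ellCoeff, ellF_eq_mul_tri ζ q R Ω hb]
  simp only [Module.Basis.map_apply, LinearMap.toMatrix_apply, LinearEquiv.coe_coe]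
  ring

/-- The covectors `ellF x x` are pairwise proportional. -/
lemma ellF_diag_proportional (h2 : (2 : k) ≠ 0) {ζ : V ≃ₗ[k] V} {q : k}
    {R : V ⊗[k] V →ₗ[k] V ⊗[k] V} (hR : IsHeckeSymmetry k V q R)
    (hY : LinearMap.range (skewY k V q R) = Ups2 k V ζ) {ω : AlternatingMap k V k (Fin 3)}
    {Ω : V ⊗[k] (V ⊗[k] V) →ₗ[k] k}
    (hΩ : ∀ x y z : V, Ω (wedge3 k V ζ x y z) = ω ![x, y, z]) {b : Module.Basis (Fin 3) k V}
    (hb : ω b ≠ 0) (hb' : ω (b.map ζ) ≠ 0) (x y u v : V) :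
    ellF k V ζ q R Ω x x u * ellF k V ζ q R Ω y y v
      = ellF k V ζ q R Ω x x v * ellF k V ζ q R Ω y y u := by
  obtain ⟨E, hE⟩ := mixAdj_ellCoeff h2 hR hY hΩ hb hb'
  let φ := algebraMap k (AlgebraicClosure k)
  let M := (LinearMap.toMatrix b b ζ).map φ
  have hM : IsUnit M := by
    have h : IsUnit (LinearMap.toMatrixAlgEquiv b (ζ : V →ₗ[k] V)) :=
      IsUnit.map _ ((Module.End.isUnit_iff _).2 ζ.bijective)
    exact h.map φ.mapMatrix
  have hmap : ∀ x y z : Fin 3 → k, tri (fun i j l => φ (ellCoeff ζ q R Ω ω b i j l))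
      (φ ∘ x) (φ ∘ y) (φ ∘ z) = φ (tri (ellCoeff ζ q R Ω ω b) x y z) := fun x y z => by
    simp [tri]
  have key := tri_diag_proportional (τ := fun i j l => φ (ellCoeff ζ q R Ω ω b i j l))
    (τ' := fun i j l => φ (ellCoeff ζ q R Ω ω (b.map ζ) i j l)) (q := φ q) (E := E.map φ)
    (κ := φ (ω b / ω (b.map ζ))) (g := M.mulVec)
    (by simpa only [map_ofNat] using (map_ne_zero φ).2 h2) ((map_ne_zero φ).2 hR.1)
    (fun i j l => by simp only [← map_add, ellCoeff_symm hR hY hΩ b i j l])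
    (mixAdj_lastMat_firstMat fun i l c m => by
      have h := congrArg φ (hE i l c m)
      simpa [mixAdj, Matrix.one_apply, apply_ite φ] using h)
    ((map_ne_zero φ).2 (div_ne_zero hb hb'))
    (Matrix.mulVec_surjective_iff_isUnit.2 hM)
    (fun x y z => by
      rw [tri_mulVec]
      simp only [tri_ellCoeff_map ζ q R Ω hb, map_mul, ← hmap, tri_const_mul]
      rfl)
    (φ ∘ b.repr x) (φ ∘ b.repr y) (φ ∘ b.repr u) (φ ∘ b.repr v)
  simp only [hmap, ← map_mul] at key
  simp only [ellF_eq_mul_tri ζ q R Ω hb]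
  linear_combination ω b * ω b * φ.injective key

end Bridge

theorem stmt9 (hchar : ringChar k ≠ 2) (hdim : Module.finrank k V = 3)
    (ζ : V ≃ₗ[k] V) (q : k)
    (R : V ⊗[k] V →ₗ[k] V ⊗[k] V) (hR : IsHeckeSymmetry k V q R)
    (hY : LinearMap.range (skewY k V q R) = Ups2 k V ζ)
    (ω : AlternatingMap k V k (Fin 3)) (hω : ω ≠ 0)
    (Ω : V ⊗[k] (V ⊗[k] V) →ₗ[k] k)
    (hΩ : ∀ x y z : V, Ω (wedge3 k V ζ x y z) = ω ![x, y, z]) :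
    Module.finrank k
      (Submodule.span k {f : Module.Dual k V | ∃ x : V, f = ellF k V ζ q R Ω x x}) ≤ 1 := by
  have h2 : (2 : k) ≠ 0 := Ring.two_ne_zero hchar
  have : Module.Finite k V := Module.finite_of_finrank_pos (by omega)
  let b : Module.Basis (Fin 3) k V := Module.finBasisOfFinrankEq k V hdim
  have hprop := ellF_diag_proportional h2 hR hY hΩ ((ω.map_basis_ne_zero_iff b).2 hω)
    ((ω.map_basis_ne_zero_iff (b.map ζ)).2 hω)
  by_cases h0 : ∀ x, ellF k V ζ q R Ω x x = 0
  · have hbot : Submodule.span k {f : Module.Dual k V | ∃ x : V, f = ellF k V ζ q R Ω x x} = ⊥ := by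
      rw [Submodule.span_eq_bot]
      rintro _ ⟨x, rfl⟩
      exact h0 x
    rw [hbot, finrank_bot]
    exact zero_le_one
  · push Not at h0
    obtain ⟨y, hy⟩ := h0
    obtain ⟨v, hv⟩ := DFunLike.ne_iff.1 hy
    refine (Submodule.finrank_mono (t := Submodule.span k {ellF k V ζ q R Ω y y}) ?_).trans
      (finrank_span_singleton hy).le
    rw [Submodule.span_le]
    rintro _ ⟨x, rfl⟩
    refine Submodule.mem_span_singleton.2
      ⟨ellF k V ζ q R Ω x x v / ellF k V ζ q R Ω y y v, LinearMap.ext fun u => ?_⟩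
    rw [LinearMap.smul_apply, smul_eq_mul, div_mul_eq_mul_div]
    exact (div_eq_iff hv).2 (hprop x y u v).symm
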